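/- arXiv:1708.07086 — 3 statements merged into one kernel-verified Lean document; each statement's English description precedes it below -/
import Mathlib

section
/- Let f : ℝ → ℝ be three times continuously differentiable with compact support, θ > 0. Then sup_{y ∈ [0,1]} | θn·∑_{j=0}^{n} C(n,j)·p_n(y)^j·(1−p_n(y))^{n−j}·( f(j/n) − f(⌊ny⌋/n) ) − ( θ(b − (a+b)y)·f′(y) + (θ/2)·y(1−y)·f″(y) ) | → 0 as n → ∞, i.e. the convergence of the rescaled Wright–Fisher transition operators to the Jacobi generator is uniform in y ∈ [0,1]. -/
/-- Initial state `i_n(y) = ⌊n·y⌋` of the Jacobi–Wright–Fisher chain. -/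
noncomputable def jacI (y : ℝ) (n : ℕ) : ℕ := ⌊(n : ℝ) * y⌋₊

/-- Expected fraction of A-types `p_n(y) = (i_n/n)(1 − a/n) + (1 − i_n/n)(b/n)` in the
Wright–Fisher model with mutation rates `α = a/n`, `β = b/n` and no selection. -/
noncomputable def jacP (a b y : ℝ) (n : ℕ) : ℝ :=
  ((jacI y n : ℝ) / n) * (1 - a / n) + (1 - (jacI y n : ℝ) / n) * (b / n)

/-- Binomial expectation (unnormalised weights `p, 1-p`). -/
noncomputable def bE (p : ℝ) (n : ℕ) (g : ℝ → ℝ) : ℝ :=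
  ∑ j ∈ Finset.range (n + 1), (n.choose j : ℝ) * p ^ j * (1 - p) ^ (n - j) * g j

lemma bE_succ (p : ℝ) (n : ℕ) (g : ℝ → ℝ) :
    bE p (n + 1) g = p * bE p n (fun s => g (s + 1)) + (1 - p) * bE p n g := by
  unfold bE
  have h := Finset.sum_antidiagonal_choose_succ_mul
    (fun i j => p ^ i * (1 - p) ^ j * g i) n
  rw [Finset.Nat.sum_antidiagonal_eq_sum_range_succ_mk,
    Finset.Nat.sum_antidiagonal_eq_sum_range_succ_mk,
    Finset.Nat.sum_antidiagonal_eq_sum_range_succ_mk] at h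
  simp only [← mul_assoc] at h
  rw [h, add_comm, Finset.mul_sum, Finset.mul_sum]
  congr 1
  · apply Finset.sum_congr rfl
    intro j hj
    push_cast
    have : n.choose (n - j) = n.choose j :=
      Nat.choose_symm (by simpa [Nat.lt_succ_iff] using hj)
    try rw [this]
    ring
  · apply Finset.sum_congr rfl
    intro j hj
    ring

lemma bE_add (p : ℝ) (n : ℕ) (g h : ℝ → ℝ) :
    bE p n (fun s => g s + h s) = bE p n g + bE p n h := by
  simp only [bE, mul_add, Finset.sum_add_distrib]

lemma bE_smul (p : ℝ) (n : ℕ) (c : ℝ) (g : ℝ → ℝ) :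
    bE p n (fun s => c * g s) = c * bE p n g := by
  simp only [bE, Finset.mul_sum]
  exact Finset.sum_congr rfl fun j _ => by ring

lemma bE_const (p : ℝ) (n : ℕ) (c : ℝ) : bE p n (fun _ => c) = c := by
  induction n with
  | zero => simp [bE]
  | succ n ih => rw [bE_succ, ih]; ring

lemma bE_mono {p : ℝ} (h0 : 0 ≤ p) (h1 : p ≤ 1) (n : ℕ) {g h : ℝ → ℝ} (hgh : ∀ s, g s ≤ h s) :
    bE p n g ≤ bE p n h := by
  unfold bE
  have : 0 ≤ 1 - p := by linarith
  apply Finset.sum_le_sum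
  intro j _
  exact mul_le_mul_of_nonneg_left (hgh _) (by positivity)

lemma bE_m1 (p : ℝ) (n : ℕ) : bE p n (fun s => s - n * p) = 0 := by
  induction n with
  | zero => simp [bE]
  | succ n ih =>
    rw [bE_succ]
    have e1 : (fun s : ℝ => s + 1 - ((n + 1 : ℕ) : ℝ) * p) =
        fun s => (s - n * p) + (1 - p) := by ext s; push_cast; ring
    have e2 : (fun s : ℝ => s - ((n + 1 : ℕ) : ℝ) * p) =
        fun s => (s - n * p) + (- p) := by ext s; push_cast; ring
    rw [e1, e2, bE_add, bE_add, ih, bE_const, bE_const]; ring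

lemma bE_m2 (p : ℝ) (n : ℕ) : bE p n (fun s => (s - n * p) ^ 2) = n * (p * (1 - p)) := by
  induction n with
  | zero => simp [bE]
  | succ n ih =>
    rw [bE_succ]
    have e1 : (fun s : ℝ => (s + 1 - ((n + 1 : ℕ) : ℝ) * p) ^ 2) =
        fun s => (s - n * p) ^ 2 + (2 * (1 - p) * (s - n * p) + (1 - p) ^ 2) := by
      ext s; push_cast; ring
    have e2 : (fun s : ℝ => (s - ((n + 1 : ℕ) : ℝ) * p) ^ 2) =
        fun s => (s - n * p) ^ 2 + ((-2 * p) * (s - n * p) + p ^ 2) := by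
      ext s; push_cast; ring
    rw [e1, e2]
    simp only [bE_add, bE_smul, ih, bE_const, bE_m1]
    push_cast; ring

lemma bE_m4 (p : ℝ) (n : ℕ) : bE p n (fun s => (s - n * p) ^ 4) =
    3 * (p * (1 - p)) ^ 2 * (n * (n - 1)) + n * (p * (1 - p)) * (p ^ 3 + (1 - p) ^ 3) := by
  induction n with
  | zero => simp [bE]
  | succ n ih =>
    rw [bE_succ]
    have e1 : (fun s : ℝ => (s + 1 - ((n + 1 : ℕ) : ℝ) * p) ^ 4) =
        fun s => (s - n * p) ^ 4 + (4 * (1 - p) * (s - n * p) ^ 3 +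
          (6 * (1 - p) ^ 2 * (s - n * p) ^ 2 +
          (4 * (1 - p) ^ 3 * (s - n * p) + (1 - p) ^ 4))) := by
      ext s; push_cast; ring
    have e2 : (fun s : ℝ => (s - ((n + 1 : ℕ) : ℝ) * p) ^ 4) =
        fun s => (s - n * p) ^ 4 + (4 * (- p) * (s - n * p) ^ 3 +
          (6 * p ^ 2 * (s - n * p) ^ 2 +
          (4 * (- p) ^ 3 * (s - n * p) + p ^ 4))) := by
      ext s; push_cast; ring
    rw [e1, e2]
    simp only [bE_add, bE_smul, ih, bE_const, bE_m1, bE_m2]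
    push_cast; ring

lemma bE_m4_le {p : ℝ} (h0 : 0 ≤ p) (h1 : p ≤ 1) (n : ℕ) :
    bE p n (fun s => (s - n * p) ^ 4) ≤ 4 * (n : ℝ) ^ 2 := by
  rw [bE_m4]
  have hq : 0 ≤ 1 - p := by linarith
  have hpq : 0 ≤ p * (1 - p) := mul_nonneg h0 hq
  have hpq1 : p * (1 - p) ≤ 1 := by nlinarith
  have h3 : p ^ 3 + (1 - p) ^ 3 ≤ 1 := by nlinarith
  have h30 : 0 ≤ p ^ 3 + (1 - p) ^ 3 := by positivity
  have hn : (0 : ℝ) ≤ n := n.cast_nonneg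
  have hn2 : (n : ℝ) ≤ (n : ℝ) ^ 2 := by
    have : n ≤ n ^ 2 := Nat.le_self_pow (by norm_num) n
    exact_mod_cast this
  have A : (p * (1 - p)) ^ 2 ≤ 1 := pow_le_one₀ hpq hpq1
  have B : (p * (1 - p)) * (p ^ 3 + (1 - p) ^ 3) ≤ 1 := mul_le_one₀ hpq1 h30 h3
  have A' : (p * (1 - p)) ^ 2 * (n * (n - 1)) ≤ 1 * (n * (n - 1)) :=
    mul_le_mul_of_nonneg_right A (by nlinarith)
  have B' : (n : ℝ) * ((p * (1 - p)) * (p ^ 3 + (1 - p) ^ 3)) ≤ n * 1 :=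
    mul_le_mul_of_nonneg_left B hn
  nlinarith

lemma taylor3 {f : ℝ → ℝ} (hf : ContDiff ℝ 3 f) {M : ℝ}
    (hM : ∀ x, |deriv (deriv (deriv f)) x| ≤ M) (x z : ℝ) :
    |f z - f x - deriv f x * (z - x) - deriv (deriv f) x / 2 * (z - x) ^ 2| ≤
      M * |z - x| ^ 3 := by
  have hf1 : ContDiff ℝ 2 (deriv f) := by
    have : ContDiff ℝ (2 + 1) f := by norm_num; exact hf
    exact (contDiff_succ_iff_deriv.1 this).2.2
  have hf2 : ContDiff ℝ 1 (deriv (deriv f)) := by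
    have : ContDiff ℝ (1 + 1) (deriv f) := by norm_num; exact hf1
    exact (contDiff_succ_iff_deriv.1 this).2.2
  have d0 : ∀ u, HasDerivAt f (deriv f u) u := fun u =>
    (hf.differentiable (by norm_num) u).hasDerivAt
  have d1 : ∀ u, HasDerivAt (deriv f) (deriv (deriv f) u) u := fun u =>
    (hf1.differentiable (by norm_num) u).hasDerivAt
  have d2 : ∀ u, HasDerivAt (deriv (deriv f)) (deriv (deriv (deriv f)) u) u := fun u =>
    (hf2.differentiable (by norm_num) u).hasDerivAt
  have hM0 : 0 ≤ M := (abs_nonneg _).trans (hM 0)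
  have s2 : ∀ u, |deriv (deriv f) u - deriv (deriv f) x| ≤ M * |u - x| := fun u => by
    have := Convex.norm_image_sub_le_of_norm_hasDerivWithin_le (s := Set.univ) (x := x) (y := u)
      (fun v _ => (d2 v).hasDerivWithinAt) (fun v _ => hM v) convex_univ trivial trivial
    simpa using this
  have s1 : ∀ u, |deriv f u - deriv f x - deriv (deriv f) x * (u - x)| ≤ M * |u - x| ^ 2 := by
    intro u
    have := Convex.norm_image_sub_le_of_norm_hasDerivWithin_le (s := Set.uIcc x u)
      (x := x) (y := u) (C := M * |u - x|)
      (f := fun v => deriv f v - deriv f x - deriv (deriv f) x * (v - x))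
      (f' := fun v => deriv (deriv f) v - deriv (deriv f) x)
      (fun v _ => by
        have := ((d1 v).sub_const (deriv f x)).sub
          (((hasDerivAt_id v).sub_const x).const_mul (deriv (deriv f) x))
        simp only [mul_one, id] at this
        exact this.hasDerivWithinAt)
      (fun v hv => (s2 v).trans
        (mul_le_mul_of_nonneg_left (Set.abs_sub_left_of_mem_uIcc hv) hM0))
      (convex_uIcc _ _) Set.left_mem_uIcc Set.right_mem_uIcc
    simp only [Real.norm_eq_abs, sub_self, mul_zero, sub_zero] at this
    calc _ ≤ _ := this
      _ = _ := by ring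
  have := Convex.norm_image_sub_le_of_norm_hasDerivWithin_le (s := Set.uIcc x z)
      (x := x) (y := z) (C := M * |z - x| ^ 2)
      (f := fun v => f v - f x - deriv f x * (v - x) - deriv (deriv f) x / 2 * (v - x) ^ 2)
      (f' := fun v => deriv f v - deriv f x - deriv (deriv f) x * (v - x))
      (fun v _ => by
        have := (((d0 v).sub_const (f x)).sub
          (((hasDerivAt_id v).sub_const x).const_mul (deriv f x))).sub
          ((((hasDerivAt_id v).sub_const x).pow 2).const_mul (deriv (deriv f) x / 2))
        have h2 := this.hasDerivWithinAt (s := Set.uIcc x z)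
        refine HasDerivWithinAt.congr_deriv h2 ?_
        simp only [id]
        ring)
      (fun v hv => (s1 v).trans
        (mul_le_mul_of_nonneg_left
          (pow_le_pow_left₀ (abs_nonneg _) (Set.abs_sub_left_of_mem_uIcc hv) 2) hM0))
      (convex_uIcc _ _) Set.left_mem_uIcc Set.right_mem_uIcc
  simp only [Real.norm_eq_abs, sub_self, mul_zero, sub_zero] at this
  norm_num at this
  calc _ ≤ _ := this
    _ = _ := by rw [← sq_abs (z - x)]; ring

/-- The quantitative bound, around the grid point `x`. -/
lemma core {f : ℝ → ℝ} (hf : ContDiff ℝ 3 f) {M L : ℝ}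
    (hM : ∀ x, |deriv (deriv (deriv f)) x| ≤ M) (hL : ∀ x, |deriv (deriv f) x| ≤ L)
    {n : ℕ} (hn : 0 < n) {K x p d : ℝ} (hx0 : 0 ≤ x) (hx1 : x ≤ 1) (hp0 : 0 ≤ p) (hp1 : p ≤ 1)
    (hpd : p = x + d / n) (hd : |d| ≤ K) :
    |n * bE p n (fun s => f (s / n) - f x) -
      (d * deriv f x + 1 / 2 * (x * (1 - x)) * deriv (deriv f) x)| ≤
      L * (K + K ^ 2) / n + M * (33 + K ^ 2 + 8 * K ^ 4) / √n := by
  have hnR : (0 : ℝ) < n := by exact_mod_cast hn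
  have hn1 : (1 : ℝ) ≤ n := by exact_mod_cast hn
  have hM0 : 0 ≤ M := (abs_nonneg _).trans (hM 0)
  have hK0 : 0 ≤ K := (abs_nonneg _).trans hd
  obtain ⟨r, hr⟩ : ∃ r : ℝ, r = √(n : ℝ) := ⟨_, rfl⟩
  have hr0 : 0 < r := by rw [hr]; exact Real.sqrt_pos.2 hnR
  have hrn : (n : ℝ) = r ^ 2 := by rw [hr, Real.sq_sqrt hnR.le]
  rw [← hr]
  have hd2 : d ^ 2 ≤ K ^ 2 := by rw [← sq_abs]; exact pow_le_pow_left₀ (abs_nonneg _) hd 2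
  have hd4 : d ^ 4 ≤ K ^ 4 := by
    calc d ^ 4 = (d ^ 2) ^ 2 := by ring
      _ ≤ (K ^ 2) ^ 2 := pow_le_pow_left₀ (sq_nonneg _) hd2 2
      _ = K ^ 4 := by ring
  have hpq1 : p * (1 - p) ≤ 1 := by nlinarith
  have w1 : bE p n (fun s => s / n - x) = d / n := by
    have e : (fun s : ℝ => s / n - x) = fun s => (1 / n) * (s - n * p) + d / n := by
      ext s; rw [hpd]; field_simp; ring
    rw [e, bE_add, bE_smul, bE_m1, bE_const]; ring
  have w2 : bE p n (fun s => (s / n - x) ^ 2) = p * (1 - p) / n + d ^ 2 / n ^ 2 := by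
    have e : (fun s : ℝ => (s / n - x) ^ 2) = fun s => (1 / n ^ 2) * (s - n * p) ^ 2 +
        ((2 * d / n ^ 2) * (s - n * p) + d ^ 2 / n ^ 2) := by
      ext s; rw [hpd]; field_simp; ring
    rw [e, bE_add, bE_smul, bE_add, bE_smul, bE_m1, bE_m2, bE_const]; field_simp; ring
  have w4 : bE p n (fun s => (s / n - x) ^ 4) ≤ (32 + 8 * K ^ 4) / n ^ 2 := by
    have e : ∀ s : ℝ, (s / n - x) ^ 4 ≤ (8 / n ^ 4) * (s - n * p) ^ 4 + 8 * d ^ 4 / n ^ 4 := by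
      intro s
      have h8 : ∀ u v : ℝ, (u + v) ^ 4 ≤ 8 * u ^ 4 + 8 * v ^ 4 := by
        intro u v
        have h1 : (u + v) ^ 2 ≤ 2 * (u ^ 2 + v ^ 2) := by nlinarith [sq_nonneg (u - v)]
        have h2 : ((u + v) ^ 2) ^ 2 ≤ (2 * (u ^ 2 + v ^ 2)) ^ 2 :=
          pow_le_pow_left₀ (sq_nonneg _) h1 2
        nlinarith [sq_nonneg (u ^ 2 - v ^ 2)]
      have h := h8 ((s - n * p) / n) (d / n)
      have e1 : (s - n * p) / n + d / n = s / n - x := by rw [hpd]; field_simp; ring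
      rw [e1] at h
      calc _ ≤ _ := h
        _ = _ := by rw [div_pow, div_pow]; ring
    have h := bE_mono hp0 hp1 n e
    rw [bE_add, bE_smul, bE_const] at h
    have h4 := mul_le_mul_of_nonneg_left (bE_m4_le hp0 hp1 n)
      (show (0 : ℝ) ≤ 8 / n ^ 4 by positivity)
    have h5 : 8 * d ^ 4 / (n : ℝ) ^ 4 ≤ 8 * K ^ 4 / (n : ℝ) ^ 2 := by
      have : (n : ℝ) ^ 2 ≤ (n : ℝ) ^ 4 := pow_le_pow_right₀ hn1 (by norm_num)
      gcongr
    have h6 : 8 / (n : ℝ) ^ 4 * (4 * (n : ℝ) ^ 2) = 32 / n ^ 2 := by field_simp; norm_num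
    rw [add_div]
    linarith
  obtain ⟨R, hR⟩ : ∃ R : ℝ → ℝ, R = fun s => f (s / n) - f x - deriv f x * (s / n - x) -
    deriv (deriv f) x / 2 * (s / n - x) ^ 2 := ⟨_, rfl⟩
  have hRb : ∀ s, |R s| ≤ (M / r) * (s / n - x) ^ 2 + (M * r) * (s / n - x) ^ 4 := by
    intro s
    have h := taylor3 hf hM x (s / n)
    rw [hR]
    refine h.trans ?_
    have h1 : |s / n - x| ^ 3 ≤ (1 / r) * (s / n - x) ^ 2 + r * (s / n - x) ^ 4 := by
      rw [← sq_abs (s / n - x), show (s / n - x) ^ 4 = |s / n - x| ^ 4 by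
        rw [← abs_pow, abs_of_nonneg (by positivity)]]
      generalize |s / n - x| = t
      have : (1 / r) * t ^ 2 + r * t ^ 4 - t ^ 3 =
          (1 / r) * t ^ 2 * ((r * t - 1 / 2) ^ 2 + 3 / 4) := by
        field_simp; ring
      have : 0 ≤ (1 / r) * t ^ 2 * ((r * t - 1 / 2) ^ 2 + 3 / 4) := by positivity
      linarith
    calc _ ≤ _ := mul_le_mul_of_nonneg_left h1 hM0
      _ = _ := by ring
  have hER : |bE p n R| ≤ (M / r) * ((1 + K ^ 2) / n) + (M * r) * ((32 + 8 * K ^ 4) / n ^ 2) := by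
    have hw2 : bE p n (fun s => (s / n - x) ^ 2) ≤ (1 + K ^ 2) / n := by
      rw [w2, add_div]
      have : (n : ℝ) ≤ (n : ℝ) ^ 2 := by nlinarith
      gcongr
    have hub : bE p n (fun s => (M / r) * (s / n - x) ^ 2 + (M * r) * (s / n - x) ^ 4) ≤
        (M / r) * ((1 + K ^ 2) / n) + (M * r) * ((32 + 8 * K ^ 4) / n ^ 2) := by
      rw [bE_add, bE_smul, bE_smul]
      gcongr
    rw [abs_le]
    constructor
    · have h := bE_mono hp0 hp1 n (fun s => (neg_le_abs (R s)).trans (hRb s))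
      have e : bE p n (fun s => - R s) = - bE p n R := by
        have := bE_smul p n (-1) R
        simpa using this
      linarith
    · exact (bE_mono hp0 hp1 n (fun s => (le_abs_self (R s)).trans (hRb s))).trans hub
  have hsplit : bE p n (fun s => f (s / n) - f x) = deriv f x * (d / n) +
      (deriv (deriv f) x / 2 * (p * (1 - p) / n + d ^ 2 / n ^ 2) + bE p n R) := by
    rw [← w1, ← w2, ← bE_smul, ← bE_smul, ← bE_add, ← bE_add]
    congr 1
    ext s
    rw [hR]; ring
  have hmain : n * bE p n (fun s => f (s / n) - f x) -
      (d * deriv f x + 1 / 2 * (x * (1 - x)) * deriv (deriv f) x) =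
      deriv (deriv f) x * ((d * (1 - p - x) + d ^ 2) / 2 / n) + n * bE p n R := by
    rw [hsplit]
    have : p * (1 - p) = x * (1 - x) + d * (1 - p - x) / n := by rw [hpd]; field_simp; ring
    rw [this]; field_simp; ring
  rw [hmain]
  refine (abs_add_le _ _).trans (add_le_add ?_ ?_)
  · rw [abs_mul, mul_div_assoc]
    have h1 : |1 - p - x| ≤ 1 := by rw [abs_le]; constructor <;> linarith
    have h2 : |d * (1 - p - x) + d ^ 2| ≤ K + K ^ 2 := by
      refine (abs_add_le _ _).trans (add_le_add ?_ ?_)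
      · rw [abs_mul]
        calc _ ≤ K * 1 := mul_le_mul hd h1 (abs_nonneg _) hK0
          _ = K := mul_one K
      · rw [abs_of_nonneg (sq_nonneg d)]; exact hd2
    refine mul_le_mul (hL x) ?_ (abs_nonneg _) ((abs_nonneg _).trans (hL 0))
    rw [abs_div, abs_div, abs_of_pos hnR]
    gcongr
    norm_num
    linarith [abs_nonneg (d * (1 - p - x) + d ^ 2)]
  · rw [abs_mul, abs_of_pos hnR]
    refine (mul_le_mul_of_nonneg_left hER hnR.le).trans (le_of_eq ?_)
    rw [hrn]; field_simp; ring

/-- Let `f : ℝ → ℝ` be three times continuously differentiable with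
compact support, `θ > 0`. Then
`sup_{y ∈ [0,1]} |θn·∑_j C(n,j)·p_n(y)^j·(1−p_n(y))^{n−j}·(f(j/n) − f(⌊ny⌋/n))
  − (θ(b − (a+b)y)·f′(y) + (θ/2)·y(1−y)·f″(y))| → 0` as `n → ∞`,
i.e. the rescaled Wright–Fisher transition operators converge to the Jacobi generator
uniformly in `y ∈ [0,1]`. -/
theorem stmt_13 (a b θ : ℝ) (ha : 0 < a) (hb : 0 < b) (hθ : 0 < θ)
    (f : ℝ → ℝ) (hf : ContDiff ℝ 3 f) (hsupp : HasCompactSupport f) :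
    TendstoUniformlyOn
      (fun (n : ℕ) (y : ℝ) =>
        θ * (n : ℝ) * ∑ j ∈ Finset.range (n + 1),
          (n.choose j : ℝ) * (jacP a b y n) ^ j * (1 - jacP a b y n) ^ (n - j) *
            (f ((j : ℝ) / n) - f ((jacI y n : ℝ) / n)))
      (fun y : ℝ => θ * (b - (a + b) * y) * deriv f y
        + (θ / 2) * (y * (1 - y)) * deriv (deriv f) y)
      Filter.atTop (Set.Icc (0 : ℝ) 1) := by
  have hf1 : ContDiff ℝ 2 (deriv f) := by
    have : ContDiff ℝ (2 + 1) f := by norm_num; exact hf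
    exact (contDiff_succ_iff_deriv.1 this).2.2
  have hf2 : ContDiff ℝ 1 (deriv (deriv f)) := by
    have : ContDiff ℝ (1 + 1) (deriv f) := by norm_num; exact hf1
    exact (contDiff_succ_iff_deriv.1 this).2.2
  obtain ⟨L, hL⟩ := hsupp.deriv.deriv.exists_bound_of_continuous hf2.continuous
  obtain ⟨M, hM⟩ := hsupp.deriv.deriv.deriv.exists_bound_of_continuous
    (hf2.continuous_deriv (by norm_num))
  simp only [Real.norm_eq_abs] at hL hM
  set G : ℝ → ℝ := fun y : ℝ => θ * (b - (a + b) * y) * deriv f y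
        + (θ / 2) * (y * (1 - y)) * deriv (deriv f) y with hG
  have hGc : Continuous G := by
    have := hf1.continuous
    have := hf2.continuous
    fun_prop
  have hGu : UniformContinuousOn G (Set.Icc 0 1) :=
    isCompact_Icc.uniformContinuousOn_of_continuous hGc.continuousOn
  set K := a + b
  have hB : Filter.Tendsto (fun n : ℕ => θ * (L * (K + K ^ 2) / (n : ℝ) +
      M * (33 + K ^ 2 + 8 * K ^ 4) / √(n : ℝ))) Filter.atTop (nhds 0) := by
    have h1 := tendsto_const_div_atTop_nhds_zero_nat (L * (K + K ^ 2))
    have h2 : Filter.Tendsto (fun n : ℕ => M * (33 + K ^ 2 + 8 * K ^ 4) / √(n : ℝ))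
        Filter.atTop (nhds 0) :=
      (Real.tendsto_sqrt_atTop.comp tendsto_natCast_atTop_atTop).const_div_atTop _
    simpa using (h1.add h2).const_mul θ
  rw [Metric.tendstoUniformlyOn_iff]
  intro ε hε
  rw [Metric.uniformContinuousOn_iff] at hGu
  obtain ⟨δ, hδ, hGu⟩ := hGu (ε / 2) (by linarith)
  filter_upwards [hB.eventually (gt_mem_nhds (half_pos hε)), Filter.eventually_gt_atTop 0,
    (tendsto_one_div_atTop_nhds_zero_nat (𝕜 := ℝ)).eventually (gt_mem_nhds hδ),
    Filter.eventually_ge_atTop ⌈K⌉₊] with n hBn hn hnδ hnK y hy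
  have hnR : (0 : ℝ) < n := by exact_mod_cast hn
  have hKn : K ≤ n := (Nat.le_ceil K).trans (by exact_mod_cast hnK)
  set x : ℝ := (jacI y n : ℝ) / n with hx
  have hny : 0 ≤ (n : ℝ) * y := mul_nonneg hnR.le hy.1
  have hxy : x ≤ y := by
    rw [hx, div_le_iff₀ hnR, mul_comm]; exact Nat.floor_le hny
  have hyx : y - x < 1 / n := by
    have h : (n : ℝ) * y < jacI y n + 1 := Nat.lt_floor_add_one _
    have : y < ((jacI y n : ℝ) + 1) / n := by rw [lt_div_iff₀ hnR, mul_comm]; exact h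
    rw [add_div] at this
    linarith
  have hx0 : 0 ≤ x := by positivity
  have hx1 : x ≤ 1 := hxy.trans hy.2
  have hp : jacP a b y n = x * (1 - a / n) + (1 - x) * (b / n) := rfl
  have ha1 : a / n ≤ 1 := by rw [div_le_one hnR]; linarith
  have hb1 : b / n ≤ 1 := by rw [div_le_one hnR]; linarith
  have ha0 : 0 ≤ a / n := by positivity
  have hb0 : 0 ≤ b / n := by positivity
  have c := core hf hM hL hn (K := K) (x := x) (p := jacP a b y n) (d := b - K * x) hx0 hx1
    (by rw [hp]; exact add_nonneg (mul_nonneg hx0 (by linarith)) (mul_nonneg (by linarith) hb0))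
    (by rw [hp]; nlinarith)
    (by rw [hp]; simp only [K]; field_simp; ring)
    (by rw [abs_le]; simp only [K]; constructor <;> nlinarith)
  have hg := hGu y hy x ⟨hx0, hx1⟩ (by
    rw [Real.dist_eq, abs_of_nonneg (by linarith)]; linarith)
  refine (dist_triangle _ (G x) _).trans_lt ?_
  have : dist (G x) (θ * (n : ℝ) * ∑ j ∈ Finset.range (n + 1),
          (n.choose j : ℝ) * (jacP a b y n) ^ j * (1 - jacP a b y n) ^ (n - j) *
            (f ((j : ℝ) / n) - f x)) < ε / 2 := by
    refine lt_of_le_of_lt ?_ hBn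
    rw [dist_comm, Real.dist_eq]
    refine le_trans (le_of_eq ?_) (mul_le_mul_of_nonneg_left c hθ.le)
    rw [← abs_of_pos hθ, ← abs_mul, abs_of_pos hθ]
    congr 1
    simp only [hG, bE]
    ring
  linarith
end

section
/- In the CIR–Wright–Fisher scheme, the scaled conditional second moment converges: (1/n^d)·∑_{j=0}^{n} C(n,j)·p_n^j·(1−p_n)^{n−j}·(j − i_n)² → z as n → ∞; equivalently, (1/n^d)·( n·p_n·(1 − p_n) + (n·p_n − i_n)² ) → z. -/
/-- Initial state `i_n = ⌊n^d·z⌋` of the CIR–Wright–Fisher chain. -/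
noncomputable def cirI (d z : ℝ) (n : ℕ) : ℕ := ⌊(n : ℝ) ^ d * z⌋₊

/-- Expected fraction of A-types `p_n = (i_n/n)(1 − a/n^d) + (1 − i_n/n)(b/n)` in the
Wright–Fisher model with mutation rates `α = a/n^d`, `β = b/n` and no selection. -/
noncomputable def cirP (a b d z : ℝ) (n : ℕ) : ℝ :=
  ((cirI d z n : ℝ) / n) * (1 - a / (n : ℝ) ^ d) + (1 - (cirI d z n : ℝ) / n) * (b / n)

theorem binom_second_moment (n : ℕ) (p c : ℝ) :
    ∑ j ∈ Finset.range (n + 1), (n.choose j : ℝ) * p ^ j * (1 - p) ^ (n - j) * ((j : ℝ) - c) ^ 2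
      = n * p * (1 - p) + (n * p - c) ^ 2 := by
  have h0 := congrArg (Polynomial.eval p) (bernsteinPolynomial.sum ℝ n)
  have h1 := congrArg (Polynomial.eval p) (bernsteinPolynomial.sum_smul ℝ n)
  have h2 := congrArg (Polynomial.eval p) (bernsteinPolynomial.variance ℝ n)
  simp only [bernsteinPolynomial, Polynomial.eval_finsetSum, Polynomial.eval_mul,
    Polynomial.eval_pow, Polynomial.eval_sub, Polynomial.eval_X, Polynomial.eval_one,
    Polynomial.eval_natCast, nsmul_eq_mul] at h0 h1 h2
  have key : ∑ j ∈ Finset.range (n + 1),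
      (n.choose j : ℝ) * p ^ j * (1 - p) ^ (n - j) * ((j : ℝ) - c) ^ 2
      = ∑ j ∈ Finset.range (n + 1),
          ((n * p - j) ^ 2 * ((n.choose j : ℝ) * p ^ j * (1 - p) ^ (n - j)))
        + 2 * (n * p - c) * ∑ j ∈ Finset.range (n + 1),
          (j * ((n.choose j : ℝ) * p ^ j * (1 - p) ^ (n - j)))
        + (c ^ 2 - (n * p) ^ 2) * ∑ j ∈ Finset.range (n + 1),
          ((n.choose j : ℝ) * p ^ j * (1 - p) ^ (n - j)) := by
    rw [Finset.mul_sum, Finset.mul_sum, ← Finset.sum_add_distrib, ← Finset.sum_add_distrib]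
    refine Finset.sum_congr rfl fun j _ => ?_
    ring
  rw [key, h0, h1, h2]
  ring

theorem second_limit (a b d z : ℝ) (hd : d ∈ Set.Ioo (0 : ℝ) 1) (hz : 0 ≤ z) :
    Filter.Tendsto (fun n : ℕ =>
        (1 / (n : ℝ) ^ d) * ((n : ℝ) * cirP a b d z n * (1 - cirP a b d z n)
          + ((n : ℝ) * cirP a b d z n - (cirI d z n : ℝ)) ^ 2))
      Filter.atTop (nhds z) := by
  have hN : Filter.Tendsto (fun n : ℕ => (n : ℝ) ^ d) Filter.atTop Filter.atTop :=
    (tendsto_rpow_atTop hd.1).comp tendsto_natCast_atTop_atTop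
  have hv : Filter.Tendsto (fun n : ℕ => ((n : ℝ) ^ d)⁻¹) Filter.atTop (nhds 0) :=
    hN.inv_tendsto_atTop
  have hm : Filter.Tendsto (fun n : ℕ => ((n : ℝ))⁻¹) Filter.atTop (nhds 0) :=
    (tendsto_natCast_atTop_atTop (R := ℝ)).inv_tendsto_atTop
  have hu : Filter.Tendsto (fun n : ℕ => (cirI d z n : ℝ) / (n : ℝ) ^ d)
      Filter.atTop (nhds z) := by
    have := (tendsto_nat_floor_mul_div_atTop hz).comp hN
    refine this.congr fun n => ?_
    simp [cirI, mul_comm]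
  have hr : Filter.Tendsto (fun n : ℕ => (n : ℝ) ^ (-(1 - d))) Filter.atTop (nhds 0) :=
    (tendsto_rpow_neg_atTop (sub_pos.2 hd.2)).comp tendsto_natCast_atTop_atTop
  have hw : Filter.Tendsto (fun n : ℕ => (cirI d z n : ℝ) / n) Filter.atTop (nhds 0) := by
    have := hu.mul hr
    rw [mul_zero] at this
    refine this.congr' ?_
    filter_upwards [Filter.eventually_gt_atTop 0] with n hn
    have hn' : (0 : ℝ) < n := by exact_mod_cast hn
    have : (n : ℝ) ^ (-(1 - d)) = (n : ℝ) ^ d / n := by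
      rw [neg_sub, Real.rpow_sub hn', Real.rpow_one]
    rw [this]
    have := (Real.rpow_pos_of_pos hn' d).ne'
    field_simp
  have h1w := hw.const_sub 1
  have hp : Filter.Tendsto (fun n : ℕ => cirP a b d z n) Filter.atTop (nhds 0) := by
    have := (hw.mul ((hv.const_mul a).const_sub 1)).add (h1w.mul (hm.const_mul b))
    simpa [cirP, div_eq_mul_inv] using this
  have hA := (hu.sub ((hu.const_mul a).mul hv)).add ((h1w.mul_const b).mul hv)
  have hB := ((h1w.mul_const b).sub (hu.const_mul a)).pow 2
  have := (hA.mul (hp.const_sub 1)).add (hv.mul hB)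
  have e : (z - a * z * 0 + (1 - 0) * b * 0) * (1 - 0) + 0 * ((1 - 0) * b - a * z) ^ 2 = z := by
    ring
  rw [e] at this
  refine this.congr' ?_
  filter_upwards [Filter.eventually_gt_atTop 0] with n hn
  have hn' : (0 : ℝ) < n := by exact_mod_cast hn
  have hne := (Real.rpow_pos_of_pos hn' d).ne'
  have hnp : (n : ℝ) * cirP a b d z n = cirI d z n - a * (cirI d z n / (n : ℝ) ^ d)
      + (1 - (cirI d z n : ℝ) / n) * b := by
    unfold cirP
    field_simp
  rw [hnp]
  generalize cirP a b d z n = p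
  field_simp
  ring

/-- In the CIR–Wright–Fisher scheme, the scaled conditional second moment
converges: `(1/n^d)·∑_{j=0}^{n} C(n,j)·p_n^j·(1−p_n)^{n−j}·(j − i_n)² → z` as `n → ∞`;
equivalently, `(1/n^d)·(n·p_n·(1 − p_n) + (n·p_n − i_n)²) → z`. -/
theorem stmt_15 (a b d z : ℝ) (ha : 0 < a) (hb : 0 < b)
    (hd : d ∈ Set.Ioo (0 : ℝ) 1) (hz : 0 ≤ z) :
    Filter.Tendsto (fun n : ℕ =>
        (1 / (n : ℝ) ^ d) * ∑ j ∈ Finset.range (n + 1),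
          (n.choose j : ℝ) * (cirP a b d z n) ^ j * (1 - cirP a b d z n) ^ (n - j) *
            ((j : ℝ) - (cirI d z n : ℝ)) ^ 2)
      Filter.atTop (nhds z) ∧
    Filter.Tendsto (fun n : ℕ =>
        (1 / (n : ℝ) ^ d) * ((n : ℝ) * cirP a b d z n * (1 - cirP a b d z n)
          + ((n : ℝ) * cirP a b d z n - (cirI d z n : ℝ)) ^ 2))
      Filter.atTop (nhds z) := by
  have h := second_limit a b d z hd hz
  refine ⟨?_, h⟩
  simpa only [binom_second_moment] using h
end

section
/- Let f : ℝ → ℝ be three times continuously differentiable with compact support, θ > 0. Then sup_{z ≥ 0} | (θ/a)·n^d·∑_{j=0}^{n} C(n,j)·p_n(z)^j·(1−p_n(z))^{n−j}·( f(j/n^d) − f(⌊n^d z⌋/n^d) ) − ( −θ(z − b/a)·f′(z) + (1/2)(θ/a)·z·f″(z) ) | → 0 as n → ∞, i.e. the convergence of the rescaled Wright–Fisher transition operators to the CIR generator is uniform in z ∈ [0,∞). -/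
/-- Binomial expectation of `g`. -/
noncomputable def binE (n : ℕ) (p : ℝ) (g : ℕ → ℝ) : ℝ :=
  ∑ j ∈ Finset.range (n + 1), (n.choose j : ℝ) * p ^ j * (1 - p) ^ (n - j) * g j

lemma binE_succ (n : ℕ) (p : ℝ) (g : ℕ → ℝ) :
    binE (n + 1) p g = binE n p (fun j => p * g (j + 1) + (1 - p) * g j) := by
  have h2 : ∑ j ∈ Finset.range (n + 1), (n.choose (j+1) : ℝ) * p ^ (j+1) * (1 - p) ^ (n - j) * g (j+1)
      + (1 - p) ^ (n + 1) * g 0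
      = ∑ j ∈ Finset.range (n + 1), (n.choose j : ℝ) * p ^ j * (1 - p) ^ (n + 1 - j) * g j := by
    have := Finset.sum_range_succ' (fun j => (n.choose j : ℝ) * p ^ j * (1 - p) ^ (n + 1 - j) * g j) (n+1)
    rw [Finset.sum_range_succ] at this
    simp at this
    rw [this]
  unfold binE
  rw [Finset.sum_range_succ']
  simp only [Nat.choose_succ_succ, Nat.add_sub_add_right, Nat.choose_zero_right, pow_zero,
    Nat.cast_one, one_mul, Nat.sub_zero, Nat.cast_add]
  have h3 : ∀ j : ℕ, ((n.choose j : ℝ) + (n.choose (j+1) : ℝ)) * p ^ (j+1) * (1 - p) ^ (n - j) * g (j+1)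
     = (n.choose j : ℝ) * p ^ (j+1) * (1 - p) ^ (n - j) * g (j+1) +
       (n.choose (j+1) : ℝ) * p ^ (j+1) * (1 - p) ^ (n - j) * g (j+1) := by intro j; ring
  simp only [Nat.succ_eq_add_one, h3]
  rw [Finset.sum_add_distrib, add_assoc, h2, ← Finset.sum_add_distrib]
  apply Finset.sum_congr rfl
  intro j hj
  have : n + 1 - j = (n - j) + 1 := by
    have := Finset.mem_range.1 hj
    omega
  rw [this]
  ring

lemma binE_add (n : ℕ) (p : ℝ) (g h : ℕ → ℝ) :
    binE n p (fun j => g j + h j) = binE n p g + binE n p h := by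
  unfold binE
  rw [← Finset.sum_add_distrib]
  exact Finset.sum_congr rfl fun j _ => by ring

lemma binE_smul (n : ℕ) (p c : ℝ) (g : ℕ → ℝ) :
    binE n p (fun j => c * g j) = c * binE n p g := by
  unfold binE
  rw [Finset.mul_sum]
  exact Finset.sum_congr rfl fun j _ => by ring

lemma binE_one (n : ℕ) (p : ℝ) : binE n p (fun _ => 1) = 1 := by
  induction n with
  | zero => simp [binE]
  | succ n ih =>
    rw [binE_succ]
    simpa using ih

lemma binE_const (n : ℕ) (p c : ℝ) : binE n p (fun _ => c) = c := by
  have := binE_smul n p c (fun _ => 1)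
  simpa [binE_one] using this

lemma binE_mono (n : ℕ) (p : ℝ) (h0 : 0 ≤ p) (h1 : p ≤ 1) (g h : ℕ → ℝ) (H : ∀ j, g j ≤ h j) :
    binE n p g ≤ binE n p h := by
  unfold binE
  apply Finset.sum_le_sum
  intro j _
  have : 0 ≤ 1 - p := by linarith
  exact mul_le_mul_of_nonneg_left (H j) (by positivity)

lemma binE_abs (n : ℕ) (p : ℝ) (h0 : 0 ≤ p) (h1 : p ≤ 1) (g h : ℕ → ℝ) (H : ∀ j, |g j| ≤ h j) :
    |binE n p g| ≤ binE n p h := by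
  rw [abs_le]
  constructor
  · have := binE_mono n p h0 h1 (fun j => (-1) * h j) g (fun j => by
      have := (abs_le.1 (H j)).1; linarith)
    rw [binE_smul] at this
    linarith
  · exact binE_mono n p h0 h1 g h (fun j => (abs_le.1 (H j)).2)

lemma binE_m1 (n : ℕ) (p : ℝ) : binE n p (fun j => (j : ℝ) - n * p) = 0 := by
  induction n with
  | zero => simp [binE]
  | succ n ih =>
    rw [binE_succ, ← ih]
    congr 1; ext j; push_cast; ring

lemma binE_m2 (n : ℕ) (p : ℝ) : binE n p (fun j => ((j : ℝ) - n * p) ^ 2) = n * p * (1 - p) := by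
  induction n with
  | zero => simp [binE]
  | succ n ih =>
    have : binE (n+1) p (fun j => ((j : ℝ) - (n + 1 : ℕ) * p) ^ 2)
        = binE n p (fun j => ((j : ℝ) - n * p) ^ 2 + p * (1 - p)) := by
      rw [binE_succ]
      congr 1; ext j; push_cast; ring
    rw [this, binE_add, ih, binE_const]
    push_cast; ring

lemma binE_m4 (n : ℕ) (p : ℝ) : binE n p (fun j => ((j : ℝ) - n * p) ^ 4)
    = n * (p * (1 - p) * (p ^ 3 + (1 - p) ^ 3)) + 3 * (p * (1 - p)) ^ 2 * (n * (n - 1)) := by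
  induction n with
  | zero => simp [binE]
  | succ n ih =>
    have : binE (n+1) p (fun j => ((j : ℝ) - (n + 1 : ℕ) * p) ^ 4)
        = binE n p (fun j => ((j : ℝ) - n * p) ^ 4 + (6 * (p * (1 - p)) * ((j : ℝ) - n * p) ^ 2
          + (4 * (p * (1 - p) ^ 3 - (1 - p) * p ^ 3) * ((j : ℝ) - n * p)
          + p * (1 - p) * (p ^ 3 + (1 - p) ^ 3)))) := by
      rw [binE_succ]
      congr 1; ext j; push_cast; ring
    rw [this, binE_add, binE_add, binE_add, binE_smul, binE_smul, ih, binE_const, binE_m1, binE_m2]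
    push_cast; ring

lemma binE_m4_le (n : ℕ) (p : ℝ) (h0 : 0 ≤ p) (h1 : p ≤ 1) :
    binE n p (fun j => ((j : ℝ) - n * p) ^ 4) ≤ n * p + 3 * (n * p) ^ 2 := by
  rw [binE_m4]
  have hq : 0 ≤ 1 - p := by linarith
  have hn : (0:ℝ) ≤ n := n.cast_nonneg
  have e1 : p * (1 - p) * (p ^ 3 + (1 - p) ^ 3) ≤ p := by
    have a1 : p ^ 3 + (1 - p) ^ 3 ≤ 1 := by nlinarith [mul_nonneg h0 hq]
    have a2 : (1 - p) * (p ^ 3 + (1 - p) ^ 3) ≤ 1 :=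
      mul_le_one₀ (by linarith) (by positivity) a1
    nlinarith
  have e2 : (p * (1 - p)) ^ 2 ≤ p ^ 2 := by
    apply pow_le_pow_left₀ (by positivity); nlinarith
  have e3 : (p * (1 - p)) ^ 2 * (n * (n - 1)) ≤ p ^ 2 * (n * n) := by
    have : (n:ℝ) * (n - 1) ≤ n * n := by nlinarith
    calc (p * (1 - p)) ^ 2 * (n * (n - 1)) ≤ (p * (1 - p)) ^ 2 * (n * n) := by gcongr
      _ ≤ _ := by gcongr
  have := mul_le_mul_of_nonneg_left e1 hn
  nlinarith

lemma taylor2 (f f1 f2 f3 : ℝ → ℝ) (h1 : ∀ x, HasDerivAt f (f1 x) x)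
    (h2 : ∀ x, HasDerivAt f1 (f2 x) x) (h3 : ∀ x, HasDerivAt f2 (f3 x) x) (M : ℝ)
    (hM : ∀ x, |f3 x| ≤ M) (x y : ℝ) :
    |f y - f x - f1 x * (y - x) - f2 x / 2 * (y - x) ^ 2| ≤ M * |y - x| ^ 3 := by
  have hM0 : 0 ≤ M := (abs_nonneg _).trans (hM 0)
  have s2 : ∀ t, |f2 t - f2 x| ≤ M * |t - x| := by
    intro t
    have := Convex.norm_image_sub_le_of_norm_hasDerivWithin_le (f := f2) (f' := f3) (s := Set.univ)
      (C := M) (x := x) (y := t) (fun t _ => (h3 t).hasDerivWithinAt) (fun t _ => hM t)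
      convex_univ trivial trivial
    simpa using this
  have key : ∀ t ∈ Set.uIcc x y, |t - x| ≤ |y - x| := by
    intro t ht
    exact Set.abs_sub_left_of_mem_uIcc ht
  have s1 : ∀ t, |f1 t - f1 x - f2 x * (t - x)| ≤ M * |t - x| ^ 2 := by
    intro t
    have := Convex.norm_image_sub_le_of_norm_hasDerivWithin_le
      (f := fun u => f1 u - f1 x - f2 x * (u - x)) (f' := fun u => f2 u - f2 x) (s := Set.uIcc x t)
      (C := M * |t - x|) (x := x) (y := t) (fun u _ => by
        have := ((h2 u).sub_const (f1 x)).sub (((hasDerivAt_id u).sub_const x).const_mul (f2 x))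
        refine HasDerivAt.hasDerivWithinAt ?_
        refine HasDerivAt.congr_deriv (HasDerivAt.congr_of_eventuallyEq this ?_) ?_
        · exact Filter.Eventually.of_forall fun v => by simp
        · simp) (fun u hu => by
          refine (s2 u).trans ?_
          have := Set.abs_sub_left_of_mem_uIcc hu
          gcongr)
      (convex_uIcc _ _) Set.left_mem_uIcc Set.right_mem_uIcc
    simp at this
    calc _ ≤ _ := this
      _ = _ := by ring
  have := Convex.norm_image_sub_le_of_norm_hasDerivWithin_le
      (f := fun u => f u - f x - f1 x * (u - x) - f2 x / 2 * (u - x) ^ 2)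
      (f' := fun u => f1 u - f1 x - f2 x * (u - x)) (s := Set.uIcc x y)
      (C := M * |y - x| ^ 2) (x := x) (y := y) (fun u _ => by
        have := (((h1 u).sub_const (f x)).sub (((hasDerivAt_id u).sub_const x).const_mul (f1 x))).sub
          ((((hasDerivAt_id u).sub_const x).pow 2).const_mul (f2 x / 2))
        refine HasDerivAt.hasDerivWithinAt ?_
        refine HasDerivAt.congr_deriv (HasDerivAt.congr_of_eventuallyEq this ?_) ?_
        · exact Filter.Eventually.of_forall fun v => by simp
        · simp; ring) (fun u hu => by
          refine (s1 u).trans ?_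
          have := Set.abs_sub_left_of_mem_uIcc hu
          gcongr)
      (convex_uIcc _ _) Set.left_mem_uIcc Set.right_mem_uIcc
  simp only [Real.norm_eq_abs, sub_self, mul_zero, ne_eq, OfNat.ofNat_ne_zero, not_false_eq_true,
    zero_pow, sub_zero] at this
  calc _ ≤ _ := this
    _ = _ := by ring

lemma mom1 (n : ℕ) (p N i : ℝ) :
    binE n p (fun j => (j : ℝ) / N - i / N) = (n * p - i) / N := by
  have : (fun j : ℕ => (j : ℝ) / N - i / N) = fun j : ℕ => N⁻¹ * ((j : ℝ) - n * p) + (n * p - i) / N := by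
    ext j; ring
  rw [this, binE_add, binE_smul, binE_m1, binE_const]; ring

lemma mom2 (n : ℕ) (p N i : ℝ) :
    binE n p (fun j => ((j : ℝ) / N - i / N) ^ 2) = (n * p * (1 - p) + (n * p - i) ^ 2) / N ^ 2 := by
  have : (fun j : ℕ => ((j : ℝ) / N - i / N) ^ 2) = fun j : ℕ => (N⁻¹) ^ 2 * ((j : ℝ) - n * p) ^ 2
      + ((2 * (n * p - i) * (N⁻¹) ^ 2) * ((j : ℝ) - n * p) + (n * p - i) ^ 2 / N ^ 2) := by
    ext j; ring
  rw [this, binE_add, binE_add, binE_smul, binE_smul, binE_m1, binE_m2, binE_const]; ring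

lemma mom4 (n : ℕ) (p N i : ℝ) (h0 : 0 ≤ p) (h1 : p ≤ 1) :
    binE n p (fun j => ((j : ℝ) / N - i / N) ^ 4)
      ≤ 8 * (n * p + 3 * (n * p) ^ 2 + (n * p - i) ^ 4) / N ^ 4 := by
  have h : binE n p (fun j => ((j : ℝ) / N - i / N) ^ 4) ≤
      binE n p (fun j => (8 / N ^ 4) * ((j : ℝ) - n * p) ^ 4 + 8 * (n * p - i) ^ 4 / N ^ 4) := by
    apply binE_mono n p h0 h1
    intro j
    have : ∀ u v : ℝ, (u + v) ^ 4 ≤ 8 * u ^ 4 + 8 * v ^ 4 := by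
      intro u v
      have e1 : (u + v) ^ 2 ≤ 2 * (u ^ 2 + v ^ 2) := by nlinarith [sq_nonneg (u - v)]
      have e2 : ((u + v) ^ 2) ^ 2 ≤ (2 * (u ^ 2 + v ^ 2)) ^ 2 := pow_le_pow_left₀ (by positivity) e1 2
      nlinarith [sq_nonneg (u ^ 2 - v ^ 2)]
    have h2 := this (((j : ℝ) - n * p) / N) ((n * p - i) / N)
    calc _ = (((j : ℝ) - n * p) / N + (n * p - i) / N) ^ 4 := by ring
      _ ≤ _ := h2
      _ = _ := by ring
  rw [binE_add, binE_smul, binE_const] at h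
  refine h.trans ?_
  have h3 := binE_m4_le n p h0 h1
  have : 8 / N ^ 4 * binE n p (fun j => ((j : ℝ) - n * p) ^ 4) ≤ 8 / N ^ 4 * (n * p + 3 * (n * p) ^ 2) := by
    apply mul_le_mul_of_nonneg_left h3; positivity
  calc _ ≤ 8 / N ^ 4 * (n * p + 3 * (n * p) ^ 2) + 8 * (n * p - i) ^ 4 / N ^ 4 := by linarith
    _ = _ := by ring

set_option maxHeartbeats 2000000 in
/-- The moment estimates in the bounded regime. -/
lemma moments_bdd (a b K : ℝ) (ha : 0 < a) (hb : 0 < b) (hK : 0 ≤ K) : ∃ C : ℝ, 0 ≤ C ∧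
    ∀ (n : ℕ) (p N i s : ℝ), 0 ≤ p → p ≤ 1 → 1 ≤ s → N = s ^ 2 → N ≤ n → 0 ≤ i → i / N ≤ K →
      p = (i / n) * (1 - a / N) + (1 - i / n) * (b / n) →
      |N * binE n p (fun j => (j : ℝ) / N - i / N) - (b - a * (i / N))| ≤ C * (1 / s + N / n) ∧
      |N * binE n p (fun j => ((j : ℝ) / N - i / N) ^ 2) - i / N| ≤ C * (1 / s + N / n) ∧
      N * binE n p (fun j => |(j : ℝ) / N - i / N| ^ 3) ≤ C * (1 / s + N / n) := by
  obtain ⟨C1, hC1⟩ : ∃ C1, C1 = a * K + b + b * K := ⟨_, rfl⟩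
  have hC10 : 0 ≤ C1 := by rw [hC1]; positivity
  obtain ⟨D, hD⟩ : ∃ D, D = K + C1 := ⟨_, rfl⟩
  have hD0 : 0 ≤ D := by rw [hD]; positivity
  obtain ⟨Q, hQ⟩ : ∃ Q, Q = (D + C1 ^ 2) + 8 * (D + 3 * D ^ 2 + C1 ^ 4) := ⟨_, rfl⟩
  have hQ0 : 0 ≤ Q := by rw [hQ]; positivity
  refine ⟨b * K + (C1 + D * D + C1 ^ 2) + Q, by positivity, ?_⟩
  intro n p N i s h0 h1 hs hN hNn hi hx hp
  have hs0 : 0 < s := by linarith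
  have hN1 : 1 ≤ N := by rw [hN]; nlinarith
  have hN0 : 0 < N := by linarith
  have hn0 : (0:ℝ) < n := by linarith
  obtain ⟨x, hxd⟩ : ∃ x, x = i / N := ⟨_, rfl⟩
  obtain ⟨r, hr⟩ : ∃ r, r = N / (n:ℝ) := ⟨_, rfl⟩
  obtain ⟨c, hc⟩ : ∃ c, c = n * p - i := ⟨_, rfl⟩
  obtain ⟨t, ht⟩ : ∃ t, t = 1 / s := ⟨_, rfl⟩
  have ht0 : 0 < t := by rw [ht]; positivity
  have ht1 : t ≤ 1 := by rw [ht, div_le_one hs0]; exact hs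
  have htN : 1 / N = t ^ 2 := by rw [ht, hN]; field_simp
  have hr0 : 0 < r := by rw [hr]; positivity
  have hr1 : r ≤ 1 := by rw [hr, div_le_one hn0]; exact hNn
  have hix : i = x * N := by rw [hxd]; field_simp
  have hx0 : 0 ≤ x := by rw [hxd]; positivity
  rw [← hxd] at hx
  have hc' : c = b - a * x - b * x * r := by
    rw [hc, hp, hxd, hr]; field_simp; ring
  have hcabs : |c| ≤ C1 := by
    have q1 : a * x ≤ a * K := by gcongr
    have q2 : b * x * r ≤ b * K * 1 := by gcongr
    have q3 : 0 ≤ a * x := by positivity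
    have q4 : 0 ≤ b * x * r := by positivity
    have q5 : 0 ≤ a * K := by positivity
    have q6 : 0 ≤ b * K := by positivity
    rw [abs_le, hc', hC1]; constructor <;> linarith
  have hc2 : c ^ 2 ≤ C1 ^ 2 := sq_le_sq' (abs_le.1 hcabs).1 (abs_le.1 hcabs).2
  have hc4 : c ^ 4 ≤ C1 ^ 4 := by
    have := pow_le_pow_left₀ (sq_nonneg c) hc2 2
    calc c ^ 4 = (c ^ 2) ^ 2 := by ring
      _ ≤ _ := this
      _ = _ := by ring
  have hnp : n * p = x * N + c := by rw [hc, hix]; ring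
  have hnp0 : 0 ≤ n * p := by positivity
  have hnpD : n * p ≤ D * N := by
    rw [hnp, hD]
    have q1 : x * N ≤ K * N := by gcongr
    have q2 : c ≤ C1 * N := by nlinarith [(abs_le.1 hcabs).2]
    linarith
  have hpr : p ≤ D * r := by
    rw [hr, mul_div_assoc', le_div_iff₀ hn0]; linarith
  have tt : t ^ 2 ≤ t := by nlinarith
  rw [← ht, ← hr, ← hxd]
  have E1 : N * binE n p (fun j => (j : ℝ) / N - x) = c := by
    rw [hxd, mom1, ← hc]; field_simp
  have E2 : N * binE n p (fun j => ((j : ℝ) / N - x) ^ 2) = (x + c * t ^ 2) * (1 - p) + c ^ 2 * t ^ 2 := by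
    rw [hxd, mom2, ← hc, hnp, ← htN, ← hxd]; field_simp
  have E4 : N * binE n p (fun j => ((j : ℝ) / N - x) ^ 4) ≤ 8 * (D + 3 * D ^ 2 + C1 ^ 4) * t ^ 2 := by
    have := mom4 n p N i h0 h1
    rw [← hc, ← hxd] at this
    have h5 : n * p + 3 * (n * p) ^ 2 + c ^ 4 ≤ (D + 3 * D ^ 2 + C1 ^ 4) * N ^ 2 := by
      have q1 : (n * p) ^ 2 ≤ (D * N) ^ 2 := by gcongr
      have q2 : D * N ≤ D * N ^ 2 := by gcongr; nlinarith
      have q3 : C1 ^ 4 ≤ C1 ^ 4 * N ^ 2 := by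
        apply le_mul_of_one_le_right (by positivity); nlinarith
      rw [mul_pow] at q1
      rw [show (D + 3 * D ^ 2 + C1 ^ 4) * N ^ 2 = D * N ^ 2 + 3 * (D ^ 2 * N ^ 2) + C1 ^ 4 * N ^ 2 by ring]
      linarith
    calc _ ≤ N * (8 * (n * p + 3 * (n * p) ^ 2 + c ^ 4) / N ^ 4) := by gcongr
      _ ≤ N * (8 * ((D + 3 * D ^ 2 + C1 ^ 4) * N ^ 2) / N ^ 4) := by gcongr
      _ = _ := by rw [← htN]; field_simp
  have hxct : x + c * t ^ 2 ≤ D := by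
    have : n * p / N ≤ D := by rw [div_le_iff₀ hN0]; exact hnpD
    rw [hnp] at this
    calc _ = (x * N + c) / N := by rw [← htN]; field_simp
      _ ≤ D := this
  have hxct0 : 0 ≤ x + c * t ^ 2 := by
    have : 0 ≤ n * p / N := by positivity
    rw [hnp] at this
    calc _ ≤ (x * N + c) / N := this
      _ = _ := by rw [← htN]; field_simp
  have P1 : 0 ≤ b * K := by positivity
  have P2 : 0 ≤ D * D := by positivity
  have P3 : 0 ≤ C1 ^ 2 := by positivity
  refine ⟨?_, ?_, ?_⟩
  · rw [E1, hc', show b - a * x - b * x * r - (b - a * x) = -(b * x * r) by ring, abs_neg,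
      abs_of_nonneg (by positivity)]
    have : b * x * r ≤ b * K * r := by gcongr
    have h6 : 0 ≤ b * K * t := by positivity
    have h7 : 0 ≤ (C1 + D * D + C1 ^ 2 + Q) * (t + r) := by positivity
    nlinarith
  · rw [E2]
    have h6 : |(x + c * t ^ 2) * (1 - p) + c ^ 2 * t ^ 2 - x| ≤ C1 * t ^ 2 + D * (D * r) + C1 ^ 2 * t ^ 2 := by
      have g1 : |c * t ^ 2| ≤ C1 * t ^ 2 := by
        rw [abs_mul, abs_of_nonneg (sq_nonneg t)]; gcongr
      have g2 : (x + c * t ^ 2) * p ≤ D * (D * r) := by gcongr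
      have g3 : 0 ≤ (x + c * t ^ 2) * p := by positivity
      have g4 : c ^ 2 * t ^ 2 ≤ C1 ^ 2 * t ^ 2 := by gcongr
      have g5 : 0 ≤ c ^ 2 * t ^ 2 := by positivity
      have g6 := abs_le.1 g1
      rw [abs_le]; constructor <;> nlinarith
    refine h6.trans ?_
    have g1 : C1 * t ^ 2 ≤ C1 * t := by gcongr
    have g2 : C1 ^ 2 * t ^ 2 ≤ C1 ^ 2 * t := by gcongr
    have h7 : 0 ≤ (b * K + Q) * (t + r) := by positivity
    have h8 : 0 ≤ D * D * t := by positivity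
    have h9 : 0 ≤ (C1 + C1 ^ 2) * r := by positivity
    nlinarith
  · have h6 : binE n p (fun j => |(j : ℝ) / N - x| ^ 3) ≤
        binE n p (fun j => t * ((j : ℝ) / N - x) ^ 2 + s * ((j : ℝ) / N - x) ^ 4) := by
      apply binE_mono n p h0 h1
      intro j
      have g : ∀ u : ℝ, |u| ^ 3 ≤ t * u ^ 2 + s * u ^ 4 := by
        intro u
        rw [← sq_abs u, show u ^ 4 = |u| ^ 4 by rw [pow_abs, abs_of_nonneg (by positivity)]]
        have hst : s * t = 1 := by rw [ht]; field_simp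
        have hu := abs_nonneg u
        have : |u| ≤ t + s * |u| ^ 2 := by
          by_cases h : |u| ≤ t
          · have : 0 ≤ s * |u| ^ 2 := by positivity
            linarith
          · push Not at h
            have : s * t * |u| ≤ s * |u| * |u| := by gcongr
            nlinarith
        have g := mul_le_mul_of_nonneg_left this (sq_nonneg |u|)
        nlinarith
      exact g _
    rw [binE_add, binE_smul, binE_smul] at h6
    have h7 : N * binE n p (fun j => ((j : ℝ) / N - x) ^ 2) ≤ D + C1 ^ 2 := by
      rw [E2]
      have g1 : (x + c * t ^ 2) * (1 - p) ≤ D * 1 := by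
        apply mul_le_mul hxct (by linarith) (by linarith) hD0
      have g2 : c ^ 2 * t ^ 2 ≤ C1 ^ 2 * 1 := by gcongr; nlinarith
      linarith
    have hst2 : s * t ^ 2 = t := by rw [ht]; field_simp
    calc _ ≤ N * (t * binE n p (fun j => ((j : ℝ) / N - x) ^ 2) + s * binE n p (fun j => ((j : ℝ) / N - x) ^ 4)) := by gcongr
      _ = t * (N * binE n p (fun j => ((j : ℝ) / N - x) ^ 2)) + s * (N * binE n p (fun j => ((j : ℝ) / N - x) ^ 4)) := by ring
      _ ≤ t * (D + C1 ^ 2) + s * (8 * (D + 3 * D ^ 2 + C1 ^ 4) * t ^ 2) := by gcongr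
      _ = Q * t := by
        rw [hQ]; linear_combination (8 * (D + 3 * D ^ 2 + C1 ^ 4)) * hst2
      _ ≤ _ := by
        have h8 : 0 ≤ (b * K + (C1 + D * D + C1 ^ 2)) * (t + r) := by positivity
        have h9 : 0 ≤ Q * r := by positivity
        nlinarith

lemma abs_add5 {u v w y x A B C D E : ℝ} (hu : |u| ≤ A) (hv : |v| ≤ B) (hw : |w| ≤ C) (hy : |y| ≤ D)
    (hx : |x| ≤ E) : |u + v + w + y + x| ≤ A + B + C + D + E := by
  rw [abs_le] at *
  constructor <;> linarith [hu.1, hu.2, hv.1, hv.2, hw.1, hw.2, hy.1, hy.2, hx.1, hx.2]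

lemma abs_mul_bd {u v A B : ℝ} (hu : |u| ≤ A) (hv : |v| ≤ B) : |u * v| ≤ A * B := by
  rw [abs_mul]
  exact mul_le_mul hu hv (abs_nonneg _) ((abs_nonneg _).trans hu)

set_option maxHeartbeats 1000000 in
lemma bdd_case (f f1 f2 f3 : ℝ → ℝ) (h1 : ∀ x, HasDerivAt f (f1 x) x)
    (h2 : ∀ x, HasDerivAt f1 (f2 x) x) (h3 : ∀ x, HasDerivAt f2 (f3 x) x) (M : ℝ)
    (hM1 : ∀ x, |f1 x| ≤ M) (hM2 : ∀ x, |f2 x| ≤ M) (hM : ∀ x, |f3 x| ≤ M)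
    (a b K : ℝ) (ha : 0 < a) (hb : 0 < b) (hK : 0 ≤ K) : ∃ C : ℝ, 0 ≤ C ∧
    ∀ (n : ℕ) (p N i s z : ℝ), 0 ≤ p → p ≤ 1 → 1 ≤ s → N = s ^ 2 → N ≤ n → 0 ≤ i → i / N ≤ z →
      z ≤ i / N + 1 / N → z ≤ K →
      p = (i / n) * (1 - a / N) + (1 - i / n) * (b / n) →
      |N * binE n p (fun j => f ((j : ℝ) / N) - f (i / N)) - ((b - a * z) * f1 z + z / 2 * f2 z)|
        ≤ C * (1 / s + N / n) := by
  obtain ⟨C, hC0, hC⟩ := moments_bdd a b K ha hb hK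
  have hM0 : 0 ≤ M := (abs_nonneg _).trans (hM 0)
  refine ⟨M * C + M / 2 * C + M * C + ((b + a * K) * M + a * M) + (K / 2 * M + 1 / 2 * M), by positivity, ?_⟩
  intro n p N i s z hp0 hp1 hs hN hNn hi hiz hzi hzK hp
  obtain ⟨m1, m2, m3⟩ := hC n p N i s hp0 hp1 hs hN hNn hi (hiz.trans hzK) hp
  have hs0 : 0 < s := by linarith
  have hN0 : 0 < N := by rw [hN]; positivity
  have hn0 : (0:ℝ) < n := by linarith
  obtain ⟨x, hxd⟩ : ∃ x, x = i / N := ⟨_, rfl⟩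
  have hx0 : 0 ≤ x := by rw [hxd]; positivity
  rw [← hxd] at hiz hzi m1 m2 m3 ⊢
  obtain ⟨δ, hδ⟩ : ∃ δ, δ = 1 / s + N / n := ⟨_, rfl⟩
  have hzx : |x - z| ≤ δ := by
    have e1 : 1 / N ≤ 1 / s := by
      apply one_div_le_one_div_of_le hs0; rw [hN]; nlinarith
    have e2 : 0 < N / n := by positivity
    rw [hδ, abs_le]; constructor <;> linarith
  rw [← hδ] at m1 m2 m3 ⊢
  have lip : ∀ g g' : ℝ → ℝ, (∀ x, HasDerivAt g (g' x) x) → (∀ x, |g' x| ≤ M) →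
      |g x - g z| ≤ M * δ := by
    intro g g' hg hg'
    have := Convex.norm_image_sub_le_of_norm_hasDerivWithin_le (f := g) (f' := g') (s := Set.univ)
      (C := M) (x := z) (y := x) (fun t _ => (hg t).hasDerivWithinAt) (fun t _ => hg' t)
      convex_univ trivial trivial
    simp only [Real.norm_eq_abs] at this
    exact this.trans (by gcongr)
  have l1 := lip f1 f2 h2 hM2
  have l2 := lip f2 f3 h3 hM
  obtain ⟨B1, hB1⟩ : ∃ B1, B1 = binE n p (fun j => (j : ℝ) / N - x) := ⟨_, rfl⟩
  obtain ⟨B2, hB2⟩ : ∃ B2, B2 = binE n p (fun j => ((j : ℝ) / N - x) ^ 2) := ⟨_, rfl⟩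
  obtain ⟨rem, hrem⟩ : ∃ rem, rem = binE n p (fun j => f ((j : ℝ) / N) - f x - f1 x * ((j : ℝ) / N - x)
     - f2 x / 2 * ((j : ℝ) / N - x) ^ 2) := ⟨_, rfl⟩
  have hsplit : binE n p (fun j => f ((j : ℝ) / N) - f x) = f1 x * B1 + (f2 x / 2 * B2 + rem) := by
    rw [hB1, hB2, hrem, ← binE_smul, ← binE_smul, ← binE_add, ← binE_add]
    congr 1; ext j; ring
  have hremb : |N * rem| ≤ M * (C * δ) := by
    have : |rem| ≤ M * binE n p (fun j => |(j : ℝ) / N - x| ^ 3) := by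
      rw [hrem, ← binE_smul]
      exact binE_abs n p hp0 hp1 _ _ fun j => taylor2 f f1 f2 f3 h1 h2 h3 M hM x _
    rw [abs_mul, abs_of_pos hN0]
    calc _ ≤ N * (M * binE n p (fun j => |(j : ℝ) / N - x| ^ 3)) := by gcongr
      _ = M * (N * binE n p (fun j => |(j : ℝ) / N - x| ^ 3)) := by ring
      _ ≤ _ := by gcongr
  rw [← hB1] at m1
  rw [← hB2] at m2
  rw [hsplit]
  have t1 := abs_mul_bd (hM1 x) m1
  have t2 : |f2 x / 2 * (N * B2 - x)| ≤ M / 2 * (C * δ) := by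
    apply abs_mul_bd _ m2
    rw [abs_div, abs_two]; linarith [hM2 x]
  have hbx : |b - a * x| ≤ b + a * K := by
    have e1 : a * x ≤ a * K := by gcongr; linarith
    have e2 : 0 ≤ a * x := by positivity
    rw [abs_le]; constructor <;> linarith
  have t4 : |(b - a * x) * (f1 x - f1 z) + (-a * (x - z)) * f1 z| ≤ (b + a * K) * (M * δ) + a * δ * M := by
    refine (abs_add_le _ _).trans (add_le_add (abs_mul_bd hbx l1) (abs_mul_bd ?_ (hM1 z)))
    exact abs_mul_bd (by rw [abs_neg, abs_of_pos ha]) hzx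
  have t5 : |x / 2 * (f2 x - f2 z) + (1 / 2 * (x - z)) * f2 z| ≤ K / 2 * (M * δ) + 1 / 2 * δ * M := by
    refine (abs_add_le _ _).trans (add_le_add (abs_mul_bd ?_ l2) (abs_mul_bd ?_ (hM2 z)))
    · rw [abs_of_nonneg (by positivity)]; linarith
    · exact abs_mul_bd (by rw [abs_of_pos (by norm_num)]) hzx
  have := abs_add5 t1 t2 hremb t4 t5
  calc _ = _ := by congr 1; ring
    _ ≤ _ := this
    _ = _ := by ring

lemma large_case (f : ℝ → ℝ) (M R : ℝ) (hM : ∀ x, |f x| ≤ M) (hR : 0 < R)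
    (hf : ∀ x, R < |x| → f x = 0) (n : ℕ) (p N : ℝ) (hp0 : 0 ≤ p) (hp1 : p ≤ 1) (hN : 0 < N)
    (hm : 2 * R ≤ n * p / N) :
    |N * binE n p (fun j => f ((j : ℝ) / N))| ≤ 4 * M / (n * p / N) := by
  have hM0 : 0 ≤ M := (abs_nonneg _).trans (hM 0)
  obtain ⟨m, hmd⟩ : ∃ m, m = n * p / N := ⟨_, rfl⟩
  rw [← hmd] at hm ⊢
  have hm0 : 0 < m := by linarith
  have key : |binE n p (fun j => f ((j : ℝ) / N))| ≤
      binE n p (fun j => 4 * M / m ^ 2 * ((j : ℝ) / N - n * p / N) ^ 2) := by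
    apply binE_abs n p hp0 hp1
    intro j
    rw [← hmd]
    by_cases h : R < |(j : ℝ) / N|
    · rw [hf _ h, abs_zero]; positivity
    · push Not at h
      have h' := (abs_le.1 h).2
      have : (m / 2) ^ 2 ≤ ((j : ℝ) / N - m) ^ 2 := by
        rw [← neg_sq ((j : ℝ) / N - m)]
        apply pow_le_pow_left₀ (by positivity); linarith
      calc _ ≤ M := hM _
        _ = 4 * M / m ^ 2 * (m / 2) ^ 2 := by field_simp; ring
        _ ≤ _ := by gcongr
  rw [binE_smul, mom2] at key
  rw [abs_mul, abs_of_pos hN]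
  have hnp : n * p = m * N := by rw [hmd]; field_simp
  calc _ ≤ N * (4 * M / m ^ 2 * ((n * p * (1 - p) + (n * p - n * p) ^ 2) / N ^ 2)) := by gcongr
    _ = 4 * M / m * (1 - p) := by rw [hnp]; field_simp; ring
    _ ≤ 4 * M / m * 1 := by gcongr; linarith
    _ = _ := by ring

/-- Let `f : ℝ → ℝ` be three times continuously differentiable with
compact support, `θ > 0`. Then
`sup_z |(θ/a)·n^d·∑_j C(n,j)·p_n(z)^j·(1−p_n(z))^{n−j}·(f(j/n^d) − f(⌊n^d z⌋/n^d))
  − (−θ(z − b/a)·f′(z) + (1/2)(θ/a)·z·f″(z))| → 0` as `n → ∞`,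
uniformly over those `z ≥ 0` for which `i_n(z) ≤ n` and `p_n(z) ∈ [0,1]`;
stated in ε–N form of uniform convergence. -/
theorem stmt_18 (a b θ d : ℝ) (ha : 0 < a) (hb : 0 < b) (hθ : 0 < θ)
    (hd : d ∈ Set.Ioo (0 : ℝ) 1)
    (f : ℝ → ℝ) (hf : ContDiff ℝ 3 f) (hsupp : HasCompactSupport f) :
    ∀ ε > (0 : ℝ), ∀ᶠ n : ℕ in Filter.atTop, ∀ z : ℝ, 0 ≤ z →
      cirI d z n ≤ n → cirP a b d z n ∈ Set.Icc (0 : ℝ) 1 →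
      |(θ / a) * (n : ℝ) ^ d * ∑ j ∈ Finset.range (n + 1),
            (n.choose j : ℝ) * (cirP a b d z n) ^ j * (1 - cirP a b d z n) ^ (n - j) *
              (f ((j : ℝ) / (n : ℝ) ^ d) - f ((cirI d z n : ℝ) / (n : ℝ) ^ d))
        - (-θ * (z - b / a) * deriv f z + (1 / 2) * (θ / a) * z * deriv (deriv f) z)|
        < ε := by
  intro ε hε
  obtain ⟨hd0, hd1⟩ := hd
  have c1 : ContDiff ℝ 2 (deriv f) :=
    ((contDiff_succ_iff_deriv (n := 2)).1 (hf.of_le (le_of_eq (by first | rfl | norm_num | norm_cast)))).2.2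
  have c2 : ContDiff ℝ 1 (deriv (deriv f)) :=
    ((contDiff_succ_iff_deriv (n := 1)).1 (c1.of_le (le_of_eq (by first | rfl | norm_num | norm_cast)))).2.2
  have c3 : Continuous (deriv (deriv (deriv f))) := c2.continuous_deriv (le_refl _)
  have h1 : ∀ x, HasDerivAt f (deriv f x) x := fun x =>
    (hf.differentiable (by norm_num) x).hasDerivAt
  have h2 : ∀ x, HasDerivAt (deriv f) (deriv (deriv f) x) x := fun x =>
    (c1.differentiable (by norm_num) x).hasDerivAt
  have h3 : ∀ x, HasDerivAt (deriv (deriv f)) (deriv (deriv (deriv f)) x) x := fun x =>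
    (c2.differentiable (by norm_num) x).hasDerivAt
  obtain ⟨M0, hM0⟩ := hf.continuous.bounded_above_of_compact_support hsupp
  obtain ⟨M1, hM1⟩ := c1.continuous.bounded_above_of_compact_support hsupp.deriv
  obtain ⟨M2, hM2⟩ := c2.continuous.bounded_above_of_compact_support hsupp.deriv.deriv
  obtain ⟨M3, hM3⟩ := c3.bounded_above_of_compact_support hsupp.deriv.deriv.deriv
  simp only [Real.norm_eq_abs] at hM0 hM1 hM2 hM3
  obtain ⟨M, hMd⟩ : ∃ M, M = max (max M0 M1) (max M2 M3) := ⟨_, rfl⟩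
  have bM0 : ∀ x, |f x| ≤ M := fun x => (hM0 x).trans (by simp [hMd])
  have bM1 : ∀ x, |deriv f x| ≤ M := fun x => (hM1 x).trans (by simp [hMd])
  have bM2 : ∀ x, |deriv (deriv f) x| ≤ M := fun x => (hM2 x).trans (by simp [hMd])
  have bM3 : ∀ x, |deriv (deriv (deriv f)) x| ≤ M := fun x => (hM3 x).trans (by simp [hMd])
  have hMn : 0 ≤ M := (abs_nonneg _).trans (bM0 0)
  obtain ⟨R, hR0, hR⟩ : ∃ R : ℝ, 0 < R ∧ ∀ x, R < |x| → x ∉ tsupport f := by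
    obtain ⟨R, hR⟩ := hsupp.isCompact.isBounded.subset_closedBall (0:ℝ)
    refine ⟨max R 1, by positivity, fun x hx hxs => ?_⟩
    have := hR hxs
    simp at this
    exact absurd (hx.trans_le this) (by simp)
  have z0 : ∀ x, R < |x| → f x = 0 := fun x hx => image_eq_zero_of_notMem_tsupport (hR x hx)
  have z1 : ∀ x, R < |x| → deriv f x = 0 := fun x hx =>
    image_eq_zero_of_notMem_tsupport fun h => hR x hx (tsupport_deriv_subset h)
  have z2 : ∀ x, R < |x| → deriv (deriv f) x = 0 := fun x hx =>
    image_eq_zero_of_notMem_tsupport fun h => hR x hx (tsupport_deriv_subset (tsupport_deriv_subset h))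
  obtain ⟨L, hL⟩ : ∃ L, L = 4 * R + (θ / a * (8 * M)) / ε + 1 := ⟨_, rfl⟩
  have hL0 : 0 < L := by rw [hL]; positivity
  obtain ⟨C, hC0, hC⟩ := bdd_case f _ _ _ h1 h2 h3 M bM1 bM2 bM3 a b (L + 1) ha hb (by linarith)
  have T1 : Filter.Tendsto (fun n : ℕ => (n : ℝ) ^ d) Filter.atTop Filter.atTop :=
    (tendsto_rpow_atTop hd0).comp tendsto_natCast_atTop_atTop
  have T2 : Filter.Tendsto (fun n : ℕ => 1 / Real.sqrt ((n : ℝ) ^ d)) Filter.atTop (nhds 0) := by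
    simp only [one_div]
    exact (Real.tendsto_sqrt_atTop.comp T1).inv_tendsto_atTop
  have T3 : Filter.Tendsto (fun n : ℕ => (n : ℝ) ^ d / n) Filter.atTop (nhds 0) := by
    have := (tendsto_rpow_neg_atTop (y := 1 - d) (by linarith)).comp (tendsto_natCast_atTop_atTop (R := ℝ))
    refine this.congr' ?_
    filter_upwards [Filter.eventually_gt_atTop 0] with n hn
    have hn' : (0:ℝ) < n := by exact_mod_cast hn
    simp only [Function.comp]
    rw [show -(1 - d) = d - 1 by ring, Real.rpow_sub_one hn'.ne']
  have T4 : Filter.Tendsto (fun n : ℕ => θ / a * (C * (1 / Real.sqrt ((n : ℝ) ^ d) + (n : ℝ) ^ d / n)))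
      Filter.atTop (nhds 0) := by
    simpa using ((T2.add T3).const_mul C).const_mul (θ / a)
  have T5 : Filter.Tendsto (fun n : ℕ => a / (n : ℝ) ^ d + b / n) Filter.atTop (nhds 0) := by
    have q1 := T1.const_div_atTop a
    have q2 := (tendsto_natCast_atTop_atTop (R := ℝ)).const_div_atTop b
    simpa using q1.add q2
  filter_upwards [Filter.eventually_ge_atTop 1, T1.eventually_ge_atTop 1,
    T4.eventually_lt_const hε, T5.eventually_le_const (show (0:ℝ) < 1 / 2 by norm_num)]
    with n hn hN1 hsmall hhalf z hz hin hp
  have hn1 : (1:ℝ) ≤ n := by exact_mod_cast hn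
  have hNn : (n:ℝ) ^ d ≤ n := by
    calc (n:ℝ) ^ d ≤ (n:ℝ) ^ (1:ℝ) := Real.rpow_le_rpow_of_exponent_le hn1 hd1.le
      _ = n := Real.rpow_one _
  have hpdef : cirP a b d z n = ((cirI d z n : ℝ) / n) * (1 - a / (n : ℝ) ^ d)
    + (1 - (cirI d z n : ℝ) / n) * (b / n) := rfl
  obtain ⟨p, hpe⟩ : ∃ p, p = cirP a b d z n := ⟨_, rfl⟩
  rw [← hpe] at hp hpdef ⊢
  obtain ⟨N, hNe⟩ : ∃ N, N = (n:ℝ) ^ d := ⟨_, rfl⟩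
  have hile : (cirI d z n : ℝ) ≤ N * z := by
    rw [hNe]; exact Nat.floor_le (by positivity)
  have hilt : N * z < (cirI d z n : ℝ) + 1 := by
    rw [hNe]; exact Nat.lt_floor_add_one _
  obtain ⟨i, hie⟩ : ∃ i : ℝ, i = (cirI d z n : ℝ) := ⟨_, rfl⟩
  have hin' : i ≤ n := by rw [hie]; exact_mod_cast hin
  have hi0 : 0 ≤ i := by rw [hie]; positivity
  rw [← hNe] at hN1 hsmall hhalf hNn hpdef ⊢
  rw [← hie] at hpdef hile hilt ⊢
  have hN0 : 0 < N := by linarith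
  have hxz : i / N ≤ z := by rw [div_le_iff₀ hN0]; linarith
  have hzx : z ≤ i / N + 1 / N := by
    rw [← add_div, le_div_iff₀ hN0]; linarith
  obtain ⟨hp0, hp1⟩ := hp
  have htha : 0 < θ / a := by positivity
  change |θ / a * N * binE n p (fun j => f ((j : ℝ) / N) - f (i / N)) - _| < ε
  have e1 : θ / a * N * binE n p (fun j => f ((j : ℝ) / N) - f (i / N))
     - (-θ * (z - b / a) * deriv f z + (1 / 2) * (θ / a) * z * deriv (deriv f) z)
     = θ / a * (N * binE n p (fun j => f ((j : ℝ) / N) - f (i / N)) -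
       ((b - a * z) * deriv f z + z / 2 * deriv (deriv f) z)) := by
    field_simp; ring
  by_cases hzL : z ≤ L + 1
  · rw [e1, abs_mul, abs_of_pos htha]
    refine lt_of_le_of_lt ?_ hsmall
    apply mul_le_mul_of_nonneg_left _ htha.le
    exact hC n p N i (Real.sqrt N) z hp0 hp1 (by rw [Real.one_le_sqrt]; exact hN1)
      (Real.sq_sqrt hN0.le).symm hNn hi0 hxz hzx hzL hpdef
  · push Not at hzL
    have hn0 : (0:ℝ) < n := by linarith
    have h1N : 1 / N ≤ 1 := by rw [div_le_one hN0]; exact hN1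
    have hxL : L < i / N := by linarith
    have hRL : R < L := by
      have : 0 ≤ θ / a * (8 * M) / ε := by positivity
      linarith
    have hf0 : f (i / N) = 0 := z0 _ (by rw [abs_of_nonneg (by positivity)]; linarith)
    have hz1 := z1 z (by rw [abs_of_nonneg hz]; linarith)
    have hz2 := z2 z (by rw [abs_of_nonneg hz]; linarith)
    have hmx : L / 2 ≤ n * p / N := by
      have e2 : n * p / N = i / N * (1 - (a / N + b / n)) + b / N := by
        rw [hpdef]; field_simp; ring
      have e3 : 0 < b / N := by positivity
      have e4 : L * (1 / 2) ≤ i / N * (1 - (a / N + b / n)) := by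
        apply mul_le_mul hxL.le (by linarith) (by norm_num) (by positivity)
      linarith
    have h2R : 2 * R ≤ n * p / N := by
      have : 0 ≤ θ / a * (8 * M) / ε := by positivity
      linarith
    have := large_case f M R bM0 hR0 z0 n p N hp0 hp1 hN0 h2R
    rw [e1, hz1, hz2, hf0, abs_mul, abs_of_pos htha]
    simp only [sub_zero, mul_zero, add_zero]
    calc _ ≤ θ / a * (4 * M / (n * p / N)) := by gcongr
      _ ≤ θ / a * (4 * M / (L / 2)) := by gcongr
      _ = (θ / a * (8 * M)) / L := by field_simp; ring
      _ < ε := by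
        rw [div_lt_iff₀ hL0, hL]
        have e5 : ε * (θ / a * (8 * M) / ε) = θ / a * (8 * M) := by field_simp
        have e6 : 0 < ε * (4 * R + 1) := by positivity
        nlinarith
end
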